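/- arXiv:1904.12537 — 5 statements merged into one kernel-verified Lean document; each statement's English description precedes it below -/
import Mathlib

section
/- Let n ≥ 1, let σ be a permutation of Fin (2n) that is a single cycle of length 2n, and let ρ be a fixed-point-free involution of Fin (2n). Then the partition of Fin (2n) into the orbits {m, ρ m} of ρ is intersection-free with respect to σ if and only if the permutation ρ ∘ σ has exactly n + 1 orbits on Fin (2n) (fixed points counted as orbits of size 1). -/
/-- Number of orbits of the cyclic group generated by a permutation `π`
(fixed points are counted as orbits of size 1). -/
noncomputable def numOrbits {α : Type*} (π : Equiv.Perm α) : ℕ :=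
  Nat.card (MulAction.orbitRel.Quotient (Subgroup.zpowers π) α)

/-- A family `P` of subsets of `Fin N` is intersection-free with respect to the
cyclic order `σ`. -/
def InterFree {N : ℕ} (σ : Equiv.Perm (Fin N)) (P : Set (Set (Fin N))) : Prop :=
  ¬ ∃ (m : Fin N) (i j k : ℕ), 1 ≤ i ∧ i < j ∧ j < k ∧ k < N ∧
    ({m, (σ ^ j) m} : Set (Fin N)) ∈ P ∧ ({(σ ^ i) m, (σ ^ k) m} : Set (Fin N)) ∈ P

theorem aux_numOrbits_eq {α : Type*} (π : Equiv.Perm α) :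
    numOrbits π = Nat.card (Quotient (Equiv.Perm.SameCycle.setoid π)) := by
  unfold numOrbits
  have : MulAction.orbitRel (Subgroup.zpowers π) α = Equiv.Perm.SameCycle.setoid π := by
    ext x y
    rw [MulAction.orbitRel_apply, MulAction.mem_orbit_iff]
    constructor
    · rintro ⟨⟨g, k, rfl⟩, h⟩
      exact Equiv.Perm.SameCycle.symm ⟨k, h⟩
    · intro h
      obtain ⟨k, hk⟩ := Equiv.Perm.SameCycle.symm h
      exact ⟨⟨π ^ k, k, rfl⟩, hk⟩
  unfold MulAction.orbitRel.Quotient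
  rw [this]

theorem aux_merge {α : Type*} [Fintype α] (R S : Setoid α) (a b : α) (hab : ¬ R a b)
    (hS : ∀ x y, S x y ↔ R x y ∨ (R x a ∧ R b y) ∨ (R x b ∧ R a y)) :
    Nat.card (Quotient R) = Nat.card (Quotient S) + 1 := by
  classical
  have hle : ∀ x y, R x y → S x y := fun x y h => (hS x y).2 (Or.inl h)
  let f : {q : Quotient R // q ≠ Quotient.mk R b} → Quotient S :=
    fun q => Quotient.map' (s₁ := R) (s₂ := S) id hle q.1
  have hf : Function.Bijective f := by
    constructor
    · rintro ⟨p, hp⟩ ⟨q, hq⟩ h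
      induction p using Quotient.inductionOn with | _ x =>
      induction q using Quotient.inductionOn with | _ y =>
      have h1 : S x y := Quotient.exact h
      have hx : ¬ R x b := fun h => hp (Quotient.sound h)
      have hy : ¬ R y b := fun h => hq (Quotient.sound h)
      rw [hS] at h1
      rcases h1 with h1 | ⟨_, h1⟩ | ⟨h1, _⟩
      · exact Subtype.ext (Quotient.sound h1)
      · exact absurd (R.symm h1) hy
      · exact absurd h1 hx
    · intro q
      induction q using Quotient.inductionOn with | _ x =>
      by_cases hx : R x b
      · refine ⟨⟨Quotient.mk R a, fun h => hab (Quotient.exact h)⟩, ?_⟩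
        exact Quotient.sound (s := S) ((hS a x).2 (Or.inr (Or.inl ⟨R.refl a, R.symm hx⟩)))
      · exact ⟨⟨Quotient.mk R x, fun h => hx (Quotient.exact h)⟩, rfl⟩
  have h1 := Nat.card_congr (Equiv.ofBijective f hf)
  rw [← h1, Nat.card_eq_fintype_card, Nat.card_eq_fintype_card, Fintype.card_subtype_compl]
  have : 0 < Fintype.card (Quotient R) := Fintype.card_pos_iff.2 ⟨Quotient.mk R b⟩
  simp
  omega

theorem aux_le {α : Type*} (π : Equiv.Perm α) (S : Setoid α) (h : ∀ x, S x (π x)) :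
    ∀ x y, π.SameCycle x y → S x y := by
  have hn : ∀ (k : ℕ) x, S x ((π ^ k) x) := by
    intro k
    induction k with
    | zero => intro x; exact S.refl x
    | succ k ih =>
      intro x
      rw [pow_succ', Equiv.Perm.mul_apply]
      exact S.trans (ih x) (h _)
  rintro x y ⟨k, rfl⟩
  obtain ⟨k, rfl | rfl⟩ := k.eq_nat_or_neg
  · simpa using hn k x
  · have := hn k ((π ^ (-(k : ℤ))) x)
    rw [← Equiv.Perm.mul_apply, ← zpow_natCast, ← zpow_add] at this
    simp only [add_neg_cancel, zpow_zero, Equiv.Perm.one_apply] at this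
    exact S.symm this

/-- orbits of `swap a b * π` up to first return -/
theorem aux_first {α : Type*} [Fintype α] [DecidableEq α] (π : Equiv.Perm α) (a b : α)
    (hab : a ≠ b) :
    (π.SameCycle a b ∧ ¬ (Equiv.swap a b * π).SameCycle a b) ∨
    (¬ π.SameCycle a b ∧ (Equiv.swap a b * π).SameCycle a b) := by
  have hex : ∃ p : ℕ, 0 < p ∧ ((π ^ p) a = a ∨ (π ^ p) a = b) :=
    ⟨orderOf π, orderOf_pos π, Or.inl (by rw [pow_orderOf_eq_one]; rfl)⟩
  classical
  let p := Nat.find hex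
  obtain ⟨hp0, hp⟩ : 0 < p ∧ ((π ^ p) a = a ∨ (π ^ p) a = b) := Nat.find_spec hex
  have hmin : ∀ i, 0 < i → i < p → (π ^ i) a ≠ a ∧ (π ^ i) a ≠ b := by
    intro i hi hip
    have := Nat.find_min hex hip
    tauto
  set τ := Equiv.swap a b * π with hτ
  have hτi : ∀ i, i < p → (τ ^ i) a = (π ^ i) a := by
    intro i
    induction i with
    | zero => intro _; rfl
    | succ i ih =>
      intro hi
      rw [pow_succ', Equiv.Perm.mul_apply, ih (by omega), hτ, Equiv.Perm.mul_apply,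
        ← Equiv.Perm.mul_apply π, ← pow_succ']
      exact Equiv.swap_apply_of_ne_of_ne (hmin _ (by omega) hi).1 (hmin _ (by omega) hi).2
  have hτp : (τ ^ p) a = Equiv.swap a b ((π ^ p) a) := by
    obtain ⟨q, hq⟩ : ∃ q, p = q + 1 := ⟨p - 1, by omega⟩
    rw [hq, pow_succ', Equiv.Perm.mul_apply, hτi q (by omega), hτ, Equiv.Perm.mul_apply,
        ← Equiv.Perm.mul_apply π, ← pow_succ']
  -- periodicity
  have hper : ∀ (g : Equiv.Perm α), (g ^ p) a = a → (∀ i, i < p → (g ^ i) a ≠ b) →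
      ¬ g.SameCycle a b := by
    intro g hg hne h
    obtain ⟨k, -, hk⟩ := h.exists_pow_eq' 
    have h2 : ∀ m, ((g ^ p) ^ m) a = a := by
      intro m
      induction m with
      | zero => rfl
      | succ m ih => rw [pow_succ', Equiv.Perm.mul_apply, ih, hg]
    have h3 := Nat.mod_add_div k p
    rw [← h3, pow_add, pow_mul, Equiv.Perm.mul_apply, h2] at hk
    exact hne _ (Nat.mod_lt _ hp0) hk
  have hneb : ∀ i, i < p → (π ^ i) a ≠ b := by
    intro i hi
    rcases Nat.eq_zero_or_pos i with rfl | h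
    · simpa using hab
    · exact (hmin i h hi).2
  rcases hp with hp | hp
  · right
    refine ⟨hper π hp hneb, ⟨p, ?_⟩⟩
    rw [zpow_natCast, hτp, hp, Equiv.swap_apply_left]
  · left
    refine ⟨⟨p, by rw [zpow_natCast, hp]⟩, hper τ ?_ ?_⟩
    · rw [hτp, hp, Equiv.swap_apply_right]
    · intro i hi
      rw [hτi i hi]
      exact hneb i hi

theorem aux_join {α : Type*} [Fintype α] [DecidableEq α] (π : Equiv.Perm α) (a b : α)
    (h : ¬ π.SameCycle a b) : numOrbits π = numOrbits (Equiv.swap a b * π) + 1 := by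
  have hab : a ≠ b := by rintro rfl; exact h (Equiv.Perm.SameCycle.refl _ _)
  have h2 : (Equiv.swap a b * π).SameCycle a b := by
    rcases aux_first π a b hab with h1 | h1
    · exact absurd h1.1 h
    · exact h1.2
  rw [aux_numOrbits_eq, aux_numOrbits_eq]
  apply aux_merge _ _ a b h
  let R := Equiv.Perm.SameCycle.setoid π
  let S := Equiv.Perm.SameCycle.setoid (Equiv.swap a b * π)
  have hSab : S a b := h2
  have hRS : ∀ x y, R x y → S x y := by
    apply aux_le
    intro x
    have h3 : S x ((Equiv.swap a b * π) x) := ⟨1, by simp⟩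
    refine S.trans h3 ?_
    rw [Equiv.Perm.mul_apply]
    by_cases h4 : π x = a
    · rw [h4, Equiv.swap_apply_left]; exact S.symm hSab
    by_cases h5 : π x = b
    · rw [h5, Equiv.swap_apply_right]; exact hSab
    rw [Equiv.swap_apply_of_ne_of_ne h4 h5]
  let J : Setoid α := 
    { r := fun x y => R x y ∨ (R x a ∧ R b y) ∨ (R x b ∧ R a y)
      iseqv := by
        have t : ∀ {x y z}, R x y → R y z → R x z := R.trans
        have s : ∀ {x y}, R x y → R y x := R.symm
        refine ⟨fun x => Or.inl (R.refl x), ?_, ?_⟩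
        · rintro x y (h | ⟨h, h'⟩ | ⟨h, h'⟩)
          · exact Or.inl (s h)
          · exact Or.inr (Or.inr ⟨s h', s h⟩)
          · exact Or.inr (Or.inl ⟨s h', s h⟩)
        · rintro x y z (h | ⟨h, h'⟩ | ⟨h, h'⟩) (k | ⟨k, k'⟩ | ⟨k, k'⟩)
          · exact Or.inl (t h k)
          · exact Or.inr (Or.inl ⟨t h k, k'⟩)
          · exact Or.inr (Or.inr ⟨t h k, k'⟩)
          · exact Or.inr (Or.inl ⟨h, t h' k⟩)
          · exact Or.inl (t h (t (s (t h' k)) k'))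
          · exact Or.inl (t h k')
          · exact Or.inr (Or.inr ⟨h, t h' k⟩)
          · exact Or.inl (t h k')
          · exact Or.inl (t h (t (s (t h' k)) k')) }
  intro x y
  constructor
  · refine aux_le (Equiv.swap a b * π) J ?_ x y
    intro x
    have h3 : R x (π x) := ⟨1, by simp⟩
    rw [Equiv.Perm.mul_apply]
    by_cases h4 : π x = a
    · rw [h4, Equiv.swap_apply_left]
      rw [h4] at h3
      exact Or.inr (Or.inl ⟨h3, R.refl b⟩)
    by_cases h5 : π x = b
    · rw [h5, Equiv.swap_apply_right]
      rw [h5] at h3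
      exact Or.inr (Or.inr ⟨h3, R.refl a⟩)
    rw [Equiv.swap_apply_of_ne_of_ne h4 h5]
    exact Or.inl h3
  · rintro (h | ⟨h, h'⟩ | ⟨h, h'⟩)
    · exact hRS _ _ h
    · exact S.trans (hRS _ _ h) (S.trans hSab (hRS _ _ h'))
    · exact S.trans (hRS _ _ h) (S.trans (S.symm hSab) (hRS _ _ h'))

theorem aux_split {α : Type*} [Fintype α] [DecidableEq α] (π : Equiv.Perm α) (a b : α)
    (hab : a ≠ b) (h : π.SameCycle a b) :
    numOrbits (Equiv.swap a b * π) = numOrbits π + 1 := by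
  have h2 : ¬ (Equiv.swap a b * π).SameCycle a b := by
    rcases aux_first π a b hab with h1 | h1
    · exact h1.2
    · exact absurd h h1.1
  have := aux_join _ a b h2
  rwa [← mul_assoc, Equiv.swap_mul_self, one_mul] at this

theorem aux_swap_le {α : Type*} [Fintype α] [DecidableEq α] (π : Equiv.Perm α) (a b : α)
    (hab : a ≠ b) :
    numOrbits (Equiv.swap a b * π) ≤ numOrbits π + 1 := by
  by_cases h : π.SameCycle a b
  · exact (aux_split π a b hab h).le
  · have := aux_join π a b h
    omega

theorem aux_red {α : Type*} [Fintype α] [DecidableEq α] (ρ : Equiv.Perm α)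
    (h : ρ * ρ = 1) (x : α) (hx : ρ x ≠ x) :
    ∃ ρ' : Equiv.Perm α, ρ = Equiv.swap x (ρ x) * ρ' ∧ ρ' * ρ' = 1 ∧
      ρ'.support.card + 2 = ρ.support.card ∧ ρ' x = x ∧ ρ' (ρ x) = ρ x ∧
      (∀ y, y ≠ x → y ≠ ρ x → ρ' y = ρ y) := by
  have hh : ∀ y, ρ (ρ y) = y := fun y => by rw [← Equiv.Perm.mul_apply, h]; rfl
  have e1 : (Equiv.swap x (ρ x) * ρ) x = x := by simp
  have e2 : (Equiv.swap x (ρ x) * ρ) (ρ x) = ρ x := by simp [hh]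
  have e3 : ∀ y, y ≠ x → y ≠ ρ x → (Equiv.swap x (ρ x) * ρ) y = ρ y := by
    intro y h1 h2
    rw [Equiv.Perm.mul_apply]
    apply Equiv.swap_apply_of_ne_of_ne
    · intro h3; apply h2; rw [← h3, hh]
    · intro h3; exact h1 (ρ.injective h3)
  refine ⟨Equiv.swap x (ρ x) * ρ, ?_, ?_, ?_, e1, e2, e3⟩
  · rw [← mul_assoc, Equiv.swap_mul_self, one_mul]
  · ext y
    rw [Equiv.Perm.mul_apply, Equiv.Perm.one_apply]
    by_cases h1 : y = x
    · rw [h1, e1, e1]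
    by_cases h2 : y = ρ x
    · rw [h2, e2, e2]
    rw [e3 y h1 h2, e3, hh]
    · intro h3; apply h2; rw [← h3, hh]
    · intro h3; exact h1 (ρ.injective h3)
  · have : ρ.support = insert x (insert (ρ x) (Equiv.swap x (ρ x) * ρ).support) := by
      ext y
      simp only [Finset.mem_insert, Equiv.Perm.mem_support]
      by_cases h1 : y = x
      · simp [h1, hx]
      by_cases h2 : y = ρ x
      · simp [h2, hh, hx.symm]
      rw [e3 y h1 h2]
      simp [h1, h2]
    rw [this, Finset.card_insert_of_notMem, Finset.card_insert_of_notMem]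
    · rw [Equiv.Perm.mem_support, e2]; simp
    · rw [Finset.mem_insert, Equiv.Perm.mem_support, e1]; simp [hx.symm]

theorem aux_ub {α : Type*} [Fintype α] [DecidableEq α] (π : Equiv.Perm α) :
    ∀ (k : ℕ) (ρ : Equiv.Perm α), ρ * ρ = 1 → ρ.support.card = k →
      2 * numOrbits (ρ * π) ≤ 2 * numOrbits π + k := by
  intro k
  induction k using Nat.strong_induction_on with | _ k ih =>
  intro ρ h hk
  by_cases h1 : ρ = 1
  · subst h1; simp
  obtain ⟨x, hx⟩ : ∃ x, ρ x ≠ x := by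
    by_contra! hc
    exact h1 (Equiv.ext hc)
  obtain ⟨ρ', e, h2, h3, -⟩ := aux_red ρ h x hx
  have := ih ρ'.support.card (by omega) ρ' h2 rfl
  have h4 := aux_swap_le (ρ' * π) x (ρ x) hx.symm
  rw [← mul_assoc, ← e] at h4
  omega

theorem aux_lb {α : Type*} [Fintype α] [DecidableEq α] (σ : Equiv.Perm α) (N : ℕ)
    (hsurj : ∀ x y, ∃ i, i < N ∧ (σ ^ i) x = y)
    (hinj : ∀ (y : α) (i l : ℕ), i < l → l < N → (σ ^ i) y ≠ (σ ^ l) y)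
    (hone : 2 * numOrbits σ = 2) :
    ∀ (k : ℕ) (ρ : Equiv.Perm α), ρ * ρ = 1 → ρ.support.card = k →
      (¬ ∃ (m : α) (i j k : ℕ), 1 ≤ i ∧ i < j ∧ j < k ∧ k < N ∧ ρ m = (σ ^ j) m ∧
        ρ ((σ ^ i) m) = (σ ^ k) m) →
      2 * numOrbits (ρ * σ) = 2 + k := by
  intro k
  induction k using Nat.strong_induction_on with | _ k ih =>
  intro ρ h hk hnc
  by_cases h1 : ρ = 1
  · subst h1; simp at hk; subst hk; simpa using hone
  have hh : ∀ y, ρ (ρ y) = y := fun y => by rw [← Equiv.Perm.mul_apply, h]; rfl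
  have hex : ∃ j : ℕ, j < N ∧ ∃ x, ρ x ≠ x ∧ ρ x = (σ ^ j) x := by
    obtain ⟨x, hx⟩ : ∃ x, ρ x ≠ x := by
      by_contra! hc
      exact h1 (Equiv.ext hc)
    obtain ⟨j, hj, e⟩ := hsurj x (ρ x)
    exact ⟨j, hj, x, hx, e.symm⟩
  classical
  let j := Nat.find hex
  obtain ⟨hjN, x, hx, hxj⟩ : j < N ∧ ∃ x, ρ x ≠ x ∧ ρ x = (σ ^ j) x := Nat.find_spec hex
  have hmin : ∀ i, i < j → ∀ y, ρ y = (σ ^ i) y → ρ y = y := by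
    intro i hi y hy
    by_contra hc
    exact Nat.find_min hex hi ⟨by omega, y, hc, hy⟩
  have hfix : ∀ i, 0 < i → i < j → ρ ((σ ^ i) x) = (σ ^ i) x := by
    intro i hi hij
    obtain ⟨l, hl, e⟩ := hsurj x (ρ ((σ ^ i) x))
    rcases lt_trichotomy l j with h2 | h2 | h2
    · rcases le_total i l with h3 | h3
      · apply hmin (l - i) (by omega)
        rw [← e, ← Equiv.Perm.mul_apply, ← pow_add]
        congr 2; omega
      · have h4 : ρ ((σ ^ l) x) = (σ ^ l) x := by
          apply hmin (i - l) (by omega)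
          rw [e, hh, ← e, ← Equiv.Perm.mul_apply, ← pow_add]
          congr 2; omega
        rw [e, hh] at h4
        exact h4.symm
    · subst h2
      rw [← hxj] at e
      have h5 : x = (σ ^ i) x := ρ.injective e
      exfalso
      apply hx
      apply hmin (j - i) (by omega)
      rw [hxj]
      conv_rhs => rw [h5]
      rw [← Equiv.Perm.mul_apply, ← pow_add]
      congr 2; omega
    · exact absurd ⟨x, i, j, l, hi, hij, h2, hl, hxj, e.symm⟩ hnc
  obtain ⟨ρ', e, h2, h3, f1, f2, f3⟩ := aux_red ρ h x hx
  have f4 : ∀ y, ρ y = y → ρ' y = y := by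
    intro y hy
    by_cases h4 : y = x
    · rw [h4, f1]
    by_cases h5 : y = ρ x
    · rw [h5, f2]
    rw [f3 y h4 h5, hy]
  have hsc : ∀ i, i ≤ j → ((ρ' * σ) ^ i) x = (σ ^ i) x := by
    intro i
    induction i with
    | zero => intro _; rfl
    | succ i ih =>
      intro hi
      rw [pow_succ', Equiv.Perm.mul_apply, ih (by omega), Equiv.Perm.mul_apply,
        ← Equiv.Perm.mul_apply σ, ← pow_succ']
      rcases hi.lt_or_eq with h6 | h6
      · exact f4 _ (hfix _ (by omega) h6)
      · rw [h6, ← hxj, f2]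
  have hS : (ρ' * σ).SameCycle x (ρ x) := ⟨j, by rw [zpow_natCast, hsc j le_rfl, hxj]⟩
  have h7 := aux_split _ _ _ hx.symm hS
  rw [← mul_assoc, ← e] at h7
  have hj0 : (σ ^ j) x ≠ x := hxj ▸ hx
  have hρ' : ∀ y, ρ' y ≠ y → ρ' y = ρ y := by
    intro y hy
    apply f3
    · rintro rfl; exact hy f1
    · rintro rfl; exact hy f2
  have := ih ρ'.support.card (by omega) ρ' h2 rfl (by
    rintro ⟨m, i, j, k, a1, a2, a3, a4, a5, a6⟩
    apply hnc
    refine ⟨m, i, j, k, a1, a2, a3, a4, ?_, ?_⟩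
    · rw [← a5]; refine (hρ' _ ?_).symm
      rw [a5]; exact (hinj m 0 j (by omega) (by omega)).symm
    · rw [← a6]; refine (hρ' _ ?_).symm
      rw [a6]; exact (hinj m i k (by omega) (by omega)).symm)
  omega

theorem stmt0 (n : ℕ) (hn : 1 ≤ n) (σ ρ : Equiv.Perm (Fin (2 * n)))
    (hσ : σ.IsCycle) (hσlen : σ.support.card = 2 * n)
    (hρ2 : ρ * ρ = 1) (hρfix : ∀ m, ρ m ≠ m) :
    InterFree σ (Set.range fun m => ({m, ρ m} : Set (Fin (2 * n)))) ↔
      numOrbits (ρ * σ) = n + 1 := by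
  have hh : ∀ y, ρ (ρ y) = y := fun y => by rw [← Equiv.Perm.mul_apply, hρ2]; rfl
  have hpair : ∀ x y : Fin (2 * n), ({x, y} : Set (Fin (2 * n))) ∈
      (Set.range fun m => ({m, ρ m} : Set (Fin (2 * n)))) ↔ ρ x = y := by
    intro x y
    constructor
    · rintro ⟨m, hm⟩
      rcases Set.pair_eq_pair_iff.1 hm with ⟨rfl, rfl⟩ | ⟨rfl, rfl⟩
      · rfl
      · exact hh _
    · rintro rfl
      exact ⟨x, rfl⟩
  have hsupp : σ.support = Finset.univ := by
    rw [← Finset.card_eq_iff_eq_univ, hσlen, Fintype.card_fin]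
  have hmem : ∀ x, σ x ≠ x := fun x => by
    rw [← Equiv.Perm.mem_support, hsupp]; exact Finset.mem_univ x
  have hord : orderOf σ = 2 * n := by rw [hσ.orderOf, hσlen]
  have hsc : ∀ x y, σ.SameCycle x y := fun x y => hσ.sameCycle (hmem x) (hmem y)
  have hsurj : ∀ x y, ∃ i, i < 2 * n ∧ (σ ^ i) x = y := by
    intro x y
    obtain ⟨i, hi, e⟩ := (hsc x y).exists_pow_eq'
    exact ⟨i, hord ▸ hi, e⟩
  have hinj : ∀ (y : Fin (2 * n)) (i l : ℕ), i < l → l < 2 * n → (σ ^ i) y ≠ (σ ^ l) y := by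
    intro y i l h1 h2 h3
    have h4 : l = (l - i) + i := by omega
    rw [h4, pow_add, Equiv.Perm.mul_apply] at h3
    have h5 : σ ^ (l - i) = 1 := by
      rw [hσ.pow_eq_one_iff]
      refine ⟨(σ ^ i) y, hmem _, h3.symm⟩
    have h6 := orderOf_dvd_of_pow_eq_one h5
    rw [hord] at h6
    have := Nat.le_of_dvd (by omega) h6
    omega
  let x0 : Fin (2 * n) := ⟨0, by omega⟩
  have hone : numOrbits σ = 1 := by
    rw [aux_numOrbits_eq, Nat.card_eq_one_iff_unique]
    refine ⟨⟨?_⟩, ⟨Quotient.mk _ x0⟩⟩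
    intro p q
    induction p using Quotient.inductionOn with | _ x =>
    induction q using Quotient.inductionOn with | _ y =>
    exact Quotient.sound (hsc x y)
  have hρs : ρ.support.card = 2 * n := by
    have : ρ.support = Finset.univ := by
      ext x; simp [hρfix x]
    rw [this, Finset.card_univ, Fintype.card_fin]
  unfold InterFree
  simp only [hpair]
  constructor
  · intro h
    have := aux_lb σ (2 * n) hsurj hinj (by omega) (2 * n) ρ hρ2 hρs h
    omega
  · rintro h ⟨m, i, j, k, a1, a2, a3, a4, a5, a6⟩
    obtain ⟨ρ', e, h2, h3, f1, f2, f3⟩ := aux_red ρ hρ2 m (hρfix m)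
    have g1 : ρ' ((σ ^ i) m) = (σ ^ k) m := by
      rw [f3, a6]
      · exact (hinj m 0 i (by omega) (by omega)).symm
      · rw [a5]; exact hinj m i j (by omega) (by omega)
    have g2 : (σ ^ i) m ≠ (σ ^ k) m := hinj m i k (by omega) (by omega)
    obtain ⟨ρ'', e', h2', h3', -⟩ := aux_red ρ' h2 ((σ ^ i) m) (by rw [g1]; exact g2.symm)
    rw [g1] at e'
    rw [a5] at e
    have g3 : m ≠ (σ ^ j) m := hinj m 0 j (by omega) (by omega)
    have hinv : ρ = ρ'' * (Equiv.swap ((σ ^ i) m) ((σ ^ k) m) * Equiv.swap m ((σ ^ j) m)) := by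
      have i1 : ρ⁻¹ = ρ := inv_eq_of_mul_eq_one_left hρ2
      have i2 : ρ''⁻¹ = ρ'' := inv_eq_of_mul_eq_one_left h2'
      rw [← i1, e, e', mul_inv_rev, mul_inv_rev, i2, Equiv.swap_inv, Equiv.swap_inv, mul_assoc]
    have k1 := aux_split σ _ _ g3 (hsc _ _)
    have hτ : ∀ x, σ x ≠ m → σ x ≠ (σ ^ j) m → (Equiv.swap m ((σ ^ j) m) * σ) x = σ x :=
      fun x => Equiv.swap_apply_of_ne_of_ne
    generalize hτd : Equiv.swap m ((σ ^ j) m) * σ = τ at k1 hτ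
    have c1 : ∀ i, i < j → (τ ^ i) m = (σ ^ i) m := by
      intro i
      induction i with
      | zero => intro _; rfl
      | succ i ih =>
        intro hi
        rw [pow_succ', Equiv.Perm.mul_apply, ih (by omega), hτ, ← Equiv.Perm.mul_apply, ← pow_succ']
        · rw [← Equiv.Perm.mul_apply, ← pow_succ']
          exact (hinj m 0 _ (by omega) (by omega)).symm
        · rw [← Equiv.Perm.mul_apply, ← pow_succ']
          exact hinj m _ _ (by omega) (by omega)
    have c2 : ∀ l, j + l < 2 * n → (τ ^ l) ((σ ^ j) m) = (σ ^ (j + l)) m := by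
      intro l
      induction l with
      | zero => intro _; rfl
      | succ l ih =>
        intro hi
        rw [pow_succ', Equiv.Perm.mul_apply, ih (by omega), hτ, ← Equiv.Perm.mul_apply, ← pow_succ']
        · rfl
        · rw [← Equiv.Perm.mul_apply, ← pow_succ']
          exact (hinj m 0 _ (by omega) (by omega)).symm
        · rw [← Equiv.Perm.mul_apply, ← pow_succ']
          exact (hinj m _ _ (by omega) (by omega)).symm
    have d1 : τ.SameCycle m ((σ ^ i) m) := ⟨i, by rw [zpow_natCast, c1 i a2]⟩
    have d2 : τ.SameCycle ((σ ^ j) m) ((σ ^ k) m) := ⟨(k - j : ℕ), by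
      rw [zpow_natCast, c2 _ (by omega)]; congr 2; omega⟩
    have d3 : ¬ τ.SameCycle m ((σ ^ j) m) := by
      rcases aux_first σ m ((σ ^ j) m) g3 with q | q
      · rw [← hτd]; exact q.2
      · exact absurd (hsc _ _) q.1
    have d4 : ¬ τ.SameCycle ((σ ^ i) m) ((σ ^ k) m) := fun q =>
      d3 (d1.trans (q.trans d2.symm))
    have k2 := aux_join τ _ _ d4
    have k3 := aux_ub (Equiv.swap ((σ ^ i) m) ((σ ^ k) m) * τ) _ ρ'' h2' rfl
    rw [← hτd, ← mul_assoc (Equiv.swap ((σ ^ i) m) ((σ ^ k) m)), ← mul_assoc, ← hinv, mul_assoc, hτd, h] at k3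
    omega
end

section
/- Let N ≥ 2 be even, and let P be a partition of Fin N into two-element subsets such that there are no a < b < c < d in Fin N (with the standard linear order) with {a, c} ∈ P and {b, d} ∈ P. Let σ be the cyclic permutation of Fin N sending x to x + 1 modulo N. Then P is intersection-free with respect to σ: there are no m ∈ Fin N and integers 1 ≤ i < j < k < N with {m, σ^j m} ∈ P and {σ^i m, σ^k m} ∈ P. -/
/-- `P` is a partition of `Fin N` into two-element subsets. -/
def IsPairPartition {N : ℕ} (P : Set (Set (Fin N))) : Prop :=
  (∀ s ∈ P, ∃ a b : Fin N, a ≠ b ∧ s = {a, b}) ∧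
    ∀ x : Fin N, ∃! s, s ∈ P ∧ x ∈ s

theorem stmt3 (N : ℕ) (hN : 2 ≤ N) (hNeven : Even N)
    (P : Set (Set (Fin N))) (hP : IsPairPartition P)
    (hlin : ¬ ∃ a b c d : Fin N, a < b ∧ b < c ∧ c < d ∧
      ({a, c} : Set (Fin N)) ∈ P ∧ ({b, d} : Set (Fin N)) ∈ P)
    (σ : Equiv.Perm (Fin N))
    (hσ : ∀ x : Fin N, (σ x : ℕ) = ((x : ℕ) + 1) % N) :
    InterFree σ P := by
  have hpow : ∀ (n : ℕ) (x : Fin N), n < N →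
      (((σ ^ n) x : Fin N) : ℕ) = if (x : ℕ) + n < N then (x : ℕ) + n else (x : ℕ) + n - N := by
    have hmod : ∀ (n : ℕ) (x : Fin N), (((σ ^ n) x : Fin N) : ℕ) = ((x : ℕ) + n) % N := by
      intro n x
      induction n with
      | zero => simp [Nat.mod_eq_of_lt x.isLt]
      | succ n ih =>
        rw [pow_succ', Equiv.Perm.mul_apply, hσ, ih, Nat.mod_add_mod, Nat.add_assoc]
    intro n x hn
    have hx := x.isLt
    rw [hmod]
    split_ifs with h
    · exact Nat.mod_eq_of_lt h
    · rw [Nat.mod_eq_sub_mod (by omega), Nat.mod_eq_of_lt (by omega)]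
  rintro ⟨m, i, j, k, hi, hij, hjk, hk, h1, h2⟩
  have hb := hpow i m (by omega)
  have hc := hpow j m (by omega)
  have hd := hpow k m hk
  have hm := m.isLt
  generalize (σ ^ i) m = b at *
  generalize (σ ^ j) m = c at *
  generalize (σ ^ k) m = d at *
  have h1' := h1
  have h2' := h2
  rw [Set.pair_comm] at h1' h2'
  by_cases hA : (m : ℕ) + k < N
  · refine hlin ⟨m, b, c, d, ?_, ?_, ?_, h1, h2⟩ <;> rw [Fin.lt_def] <;> split_ifs at * <;> omega
  by_cases hB : (m : ℕ) + j < N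
  · refine hlin ⟨d, m, b, c, ?_, ?_, ?_, h2', h1⟩ <;> rw [Fin.lt_def] <;> split_ifs at * <;> omega
  by_cases hC : (m : ℕ) + i < N
  · refine hlin ⟨c, d, m, b, ?_, ?_, ?_, h1', h2'⟩ <;> rw [Fin.lt_def] <;> split_ifs at * <;> omega
  · refine hlin ⟨b, c, d, m, ?_, ?_, ?_, h2, h1'⟩ <;> rw [Fin.lt_def] <;> split_ifs at * <;> omega
end

section
/- Let n ≥ 1, let σ be a cyclic permutation of Fin (2n) (a single cycle of length 2n), fix m₀ ∈ Fin (2n), and define ι : Fin (2n) → ℂ by ι(σ^k(m₀)) = exp(2πik/(2n)) for 0 ≤ k < 2n. Let P be a partition of Fin (2n) into two-element subsets, and for each pair {a, b} ∈ P let S_{a,b} ⊆ ℂ be the closed line segment joining ι(a) and ι(b). Then P is intersection-free with respect to σ if and only if the segments S_{a,b} for distinct pairs of P are pairwise disjoint. -/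
open scoped Real

def orr (x y z : ℂ) : ℝ :=
  (y.re - x.re) * (z.im - x.im) - (y.im - x.im) * (z.re - x.re)

lemma orr_exp (a b c : ℝ) (x y z : ℂ)
    (hx : x = Complex.exp ((2 * a : ℝ) * Complex.I))
    (hy : y = Complex.exp ((2 * b : ℝ) * Complex.I))
    (hz : z = Complex.exp ((2 * c : ℝ) * Complex.I)) :
    orr x y z = 4 * Real.sin (b - a) * Real.sin (c - b) * Real.sin (c - a) := by
  subst hx hy hz
  unfold orr
  simp only [Complex.exp_ofReal_mul_I_re, Complex.exp_ofReal_mul_I_im]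
  rw [Real.cos_sub_cos, Real.cos_sub_cos, Real.sin_sub_sin, Real.sin_sub_sin]
  have e : Real.sin (c - b) = Real.sin ((2 * c + 2 * a) / 2 - (2 * b + 2 * a) / 2) := by
    congr 1; ring
  rw [e, Real.sin_sub ((2 * c + 2 * a) / 2)]
  have e1 : (2 * b - 2 * a) / 2 = b - a := by ring
  have e2 : (2 * c - 2 * a) / 2 = c - a := by ring
  rw [e1, e2]
  ring

lemma cross_lemma (A B C D : ℂ) (h1 : 0 < orr B C D) (h2 : 0 < orr A C D)
    (h3 : 0 < orr A B D) (h4 : 0 < orr A B C) :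
    ∃ z, z ∈ segment ℝ A C ∧ z ∈ segment ℝ B D := by
  have hS : orr B C D + orr A B D = orr A C D + orr A B C := by unfold orr; ring
  have hpos : 0 < orr B C D + orr A B D := by positivity
  refine ⟨(orr B C D / (orr B C D + orr A B D)) • A + (orr A B D / (orr B C D + orr A B D)) • C,
    ⟨_, _, by positivity, by positivity, by field_simp, rfl⟩,
    ⟨orr A C D / (orr B C D + orr A B D), orr A B C / (orr B C D + orr A B D),
      by positivity, by positivity, by field_simp; linarith, ?_⟩⟩
  apply Complex.ext
  · simp only [Complex.add_re, Complex.real_smul, Complex.re_ofReal_mul]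
    field_simp
    unfold orr; ring
  · simp only [Complex.add_im, Complex.real_smul, Complex.im_ofReal_mul]
    field_simp
    unfold orr; ring

lemma noncross_lemma (A B C D z : ℂ) (h : 0 < orr A C B * orr A C D)
    (h1 : z ∈ segment ℝ A C) (h2 : z ∈ segment ℝ B D) : False := by
  obtain ⟨a, b, ha, hb, hab, rfl⟩ := h1
  obtain ⟨c, d, hc, hd, hcd, hh⟩ := h2
  have e : orr A C (a • A + b • C) = 0 := by
    obtain rfl : a = 1 - b := by linarith
    simp only [orr, Complex.add_re, Complex.real_smul, Complex.re_ofReal_mul,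
      Complex.add_im, Complex.im_ofReal_mul]
    ring
  rw [← hh] at e
  have e2 : orr A C (c • B + d • D) = c * orr A C B + d * orr A C D := by
    obtain rfl : c = 1 - d := by linarith
    simp only [orr, Complex.add_re, Complex.real_smul, Complex.re_ofReal_mul,
      Complex.add_im, Complex.im_ofReal_mul]
    ring
  rw [e2] at e
  have e3 : c * orr A C B ^ 2 + d * (orr A C B * orr A C D) = 0 := by
    linear_combination orr A C B * e
  have hB : 0 < orr A C B ^ 2 := by
    have : orr A C B ≠ 0 := fun h0 => by simp [h0] at h
    positivity
  rcases hc.eq_or_lt with h0 | h0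
  · have : d = 1 := by linarith
    subst this; subst h0; linarith
  · have := mul_pos h0 hB
    have := mul_nonneg hd h.le
    linarith

lemma seg_union (α : Type) (ι : α → ℂ) (a b : α) :
    (⋃ x ∈ ({a, b} : Set α), ⋃ y ∈ ({a, b} : Set α), segment ℝ (ι x) (ι y))
      = segment ℝ (ι a) (ι b) := by
  ext z
  simp only [Set.mem_iUnion, Set.mem_insert_iff, Set.mem_singleton_iff, exists_prop]
  constructor
  · rintro ⟨x, rfl | rfl, y, rfl | rfl, h⟩
    · rw [segment_same] at h; rw [Set.mem_singleton_iff.1 h]; exact left_mem_segment _ _ _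
    · exact h
    · rw [segment_symm]; exact h
    · rw [segment_same] at h; rw [Set.mem_singleton_iff.1 h]; exact right_mem_segment _ _ _
  · intro h
    exact ⟨a, Or.inl rfl, b, Or.inr rfl, h⟩

theorem stmt5 (n : ℕ) (hn : 1 ≤ n) (σ : Equiv.Perm (Fin (2 * n)))
    (hσ : σ.IsCycle) (hσlen : σ.support.card = 2 * n)
    (m₀ : Fin (2 * n)) (ι : Fin (2 * n) → ℂ)
    (hι : ∀ k : ℕ, k < 2 * n →
      ι ((σ ^ k) m₀) = Complex.exp (2 * π * Complex.I * k / (2 * n)))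
    (P : Set (Set (Fin (2 * n)))) (hP : IsPairPartition P) :
    InterFree σ P ↔
      P.Pairwise (fun s t =>
        Disjoint (⋃ a ∈ s, ⋃ b ∈ s, segment ℝ (ι a) (ι b))
                 (⋃ a ∈ t, ⋃ b ∈ t, segment ℝ (ι a) (ι b))) := by
  have hN : 0 < 2 * n := by omega
  have hNR : (0 : ℝ) < 2 * n := by exact_mod_cast hN
  have hpow : σ ^ (2 * n) = 1 := by
    have h1 := pow_orderOf_eq_one σ
    rwa [hσ.orderOf, hσlen] at h1
  have hsupp : σ.support = Finset.univ := by
    rw [← Finset.card_eq_iff_eq_univ, hσlen, Fintype.card_fin]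
  have hmov : ∀ x, σ x ≠ x := fun x => by
    rw [← Equiv.Perm.mem_support, hsupp]; exact Finset.mem_univ x
  have hmod : ∀ k x, (σ ^ k) x = (σ ^ (k % (2 * n))) x := by
    intro k x
    conv_lhs => rw [← Nat.mod_add_div k (2 * n), pow_add, pow_mul, hpow, one_pow, mul_one]
  have hsurj : ∀ x, ∃ k, k < 2 * n ∧ x = (σ ^ k) m₀ := by
    intro x
    obtain ⟨k, hk⟩ := hσ.exists_pow_eq (hmov m₀) (hmov x)
    exact ⟨k % (2 * n), Nat.mod_lt _ hN, by rw [← hmod, hk]⟩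
  have hfix : ∀ i x, 0 < i → i < 2 * n → (σ ^ i) x ≠ x := by
    intro i x hi hi2 h
    have h1 : σ ^ i = 1 := (hσ.pow_eq_one_iff' (hmov x)).2 h
    have := orderOf_le_of_pow_eq_one hi h1
    rw [hσ.orderOf] at this
    omega
  have hE : ∀ k : ℕ, ι ((σ ^ k) m₀) =
      Complex.exp ((2 * (k * (π / (2 * n))) : ℝ) * Complex.I) := by
    intro k
    rw [hmod, hι _ (Nat.mod_lt _ hN), Complex.exp_eq_exp_iff_exists_int]
    refine ⟨-((k / (2 * n) : ℕ) : ℤ), ?_⟩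
    have hk : ((k % (2 * n) : ℕ) : ℂ) = k - 2 * n * ((k / (2 * n) : ℕ) : ℂ) := by
      have := Nat.mod_add_div k (2 * n)
      have h2 : (((k % (2 * n) + 2 * n * (k / (2 * n)) : ℕ)) : ℂ) = (k : ℂ) := by rw [this]
      push_cast at h2 ⊢
      linear_combination h2
    have hn0 : (n : ℂ) ≠ 0 := by exact_mod_cast (by omega : n ≠ 0)
    rw [hk]
    generalize k / (2 * n) = d
    push_cast
    field_simp
    ring
  have hor : ∀ p q r : ℕ, orr (ι ((σ ^ p) m₀)) (ι ((σ ^ q) m₀)) (ι ((σ ^ r) m₀)) =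
      4 * Real.sin (((q : ℝ) - p) * (π / (2 * n))) * Real.sin (((r : ℝ) - q) * (π / (2 * n)))
        * Real.sin (((r : ℝ) - p) * (π / (2 * n))) := by
    intro p q r
    rw [orr_exp _ _ _ _ _ _ (hE p) (hE q) (hE r)]
    simp only [sub_mul]
  have hsin : ∀ p q : ℕ, p < q → q < p + 2 * n →
      0 < Real.sin (((q : ℝ) - p) * (π / (2 * n))) := by
    intro p q h1 h2
    have h1' : (p : ℝ) < q := by exact_mod_cast h1
    have h2' : (q : ℝ) < p + 2 * n := by exact_mod_cast h2
    apply Real.sin_pos_of_pos_of_lt_pi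
    · exact mul_pos (by linarith) (by positivity)
    · rw [← mul_div_assoc, div_lt_iff₀ hNR, mul_comm]
      exact mul_lt_mul_of_pos_left (by linarith) Real.pi_pos
  have hsinn : ∀ p q : ℕ, p < q → q < p + 2 * n →
      Real.sin (((p : ℝ) - q) * (π / (2 * n))) < 0 := by
    intro p q h1 h2
    have := hsin p q h1 h2
    rw [← neg_sub, neg_mul, Real.sin_neg]
    linarith
  have horpos : ∀ p q r : ℕ, p < q → q < r → r < p + 2 * n →
      0 < orr (ι ((σ ^ p) m₀)) (ι ((σ ^ q) m₀)) (ι ((σ ^ r) m₀)) := by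
    intro p q r h1 h2 h3
    rw [hor]
    have := hsin p q h1 (by omega)
    have := hsin q r h2 (by omega)
    have := hsin p r (by omega) (by omega)
    positivity
  have hin : ∀ p q r : ℕ, p < r → r < q → q < 2 * n →
      orr (ι ((σ ^ p) m₀)) (ι ((σ ^ q) m₀)) (ι ((σ ^ r) m₀)) < 0 := by
    intro p q r h1 h2 h3
    rw [hor]
    have a1 := hsin p q (by omega) (by omega)
    have a2 := hsinn r q h2 (by omega)
    have a3 := hsin p r (by omega) (by omega)
    exact mul_neg_of_neg_of_pos (mul_neg_of_pos_of_neg (by positivity) a2) a3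
  have hout : ∀ p q r : ℕ, p < q → (r < p ∨ q < r) → q < 2 * n → r < 2 * n →
      0 < orr (ι ((σ ^ p) m₀)) (ι ((σ ^ q) m₀)) (ι ((σ ^ r) m₀)) := by
    intro p q r h1 h2 h3 h4
    rcases h2 with h2 | h2
    · rw [hor]
      have a1 := hsin p q (by omega) (by omega)
      have a2 := hsinn r q (by omega) (by omega)
      have a3 := hsinn r p (by omega) (by omega)
      exact mul_pos_of_neg_of_neg (mul_neg_of_pos_of_neg (by positivity) a2) a3
    · exact horpos p q r h1 h2 (by omega)
  have hrep : ∀ s ∈ P, ∃ p q : ℕ, p < q ∧ q < 2 * n ∧ s = {(σ ^ p) m₀, (σ ^ q) m₀} := by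
    intro s hs
    obtain ⟨a, b, hab, rfl⟩ := hP.1 s hs
    obtain ⟨p, hp, rfl⟩ := hsurj a
    obtain ⟨q, hq, rfl⟩ := hsurj b
    rcases lt_trichotomy p q with h | h | h
    · exact ⟨p, q, h, hq, rfl⟩
    · exact absurd (by rw [h]) hab
    · exact ⟨q, p, h, hp, Set.pair_comm _ _⟩
  have hadd : ∀ p q : ℕ, p ≤ q → (σ ^ q) m₀ = (σ ^ (q - p)) ((σ ^ p) m₀) := by
    intro p q h
    rw [← Equiv.Perm.mul_apply, ← pow_add, Nat.sub_add_cancel h]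
  constructor
  · intro hI s hs t ht hst
    obtain ⟨p, q, hpq, hq, rfl⟩ := hrep s hs
    obtain ⟨r, u, hru, hu, rfl⟩ := hrep t ht
    simp only [seg_union]
    have hne : ∀ x, x ∈ ({(σ ^ p) m₀, (σ ^ q) m₀} : Set (Fin (2 * n))) →
        x ∉ ({(σ ^ r) m₀, (σ ^ u) m₀} : Set (Fin (2 * n))) := fun x h1 h2 =>
      hst ((hP.2 x).unique ⟨hs, h1⟩ ⟨ht, h2⟩)
    have n1 : p ≠ r := by rintro rfl; exact hne ((σ ^ p) m₀) (by simp) (by simp)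
    have n2 : p ≠ u := by rintro rfl; exact hne ((σ ^ p) m₀) (by simp) (by simp)
    have n3 : q ≠ r := by rintro rfl; exact hne ((σ ^ q) m₀) (by simp) (by simp)
    have n4 : q ≠ u := by rintro rfl; exact hne ((σ ^ q) m₀) (by simp) (by simp)
    have c1 : ¬ (p < r ∧ r < q ∧ q < u) := by
      rintro ⟨h1, h2, h3⟩
      refine hI ⟨(σ ^ p) m₀, r - p, q - p, u - p, by omega, by omega, by omega, by omega, ?_, ?_⟩
      · rw [← hadd p q (by omega)]; exact hs
      · rw [← hadd p r (by omega), ← hadd p u (by omega)]; exact ht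
    have c2 : ¬ (r < p ∧ p < u ∧ u < q) := by
      rintro ⟨h1, h2, h3⟩
      refine hI ⟨(σ ^ r) m₀, p - r, u - r, q - r, by omega, by omega, by omega, by omega, ?_, ?_⟩
      · rw [← hadd r u (by omega)]; exact ht
      · rw [← hadd r p (by omega), ← hadd r q (by omega)]; exact hs
    rw [Set.disjoint_left]
    intro z h1 h2
    refine noncross_lemma _ _ _ _ z ?_ h1 h2
    by_cases hr : p < r ∧ r < q
    · exact mul_pos_of_neg_of_neg (hin p q r hr.1 hr.2 hq) (hin p q u (by omega) (by omega) hq)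
    · exact mul_pos (hout p q r hpq (by omega) hq (by omega))
        (hout p q u hpq (by omega) hq (by omega))
  · rintro hD ⟨m, i, j, k, hi, hij, hjk, hk, hs, ht⟩
    have hst : ({m, (σ ^ j) m} : Set (Fin (2 * n))) ≠ {(σ ^ i) m, (σ ^ k) m} := by
      intro h
      have : m ∈ ({(σ ^ i) m, (σ ^ k) m} : Set (Fin (2 * n))) := by rw [← h]; simp
      rcases this with h | h
      · exact hfix i m (by omega) (by omega) h.symm
      · exact hfix k m (by omega) (by omega) h.symm
    have hd := hD hs ht hst
    simp only [seg_union] at hd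
    obtain ⟨p, hp, rfl⟩ := hsurj m
    simp only [← Equiv.Perm.mul_apply, ← pow_add] at hd
    obtain ⟨z, h1, h2⟩ := cross_lemma _ _ _ _
      (horpos (i + p) (j + p) (k + p) (by omega) (by omega) (by omega))
      (horpos p (j + p) (k + p) (by omega) (by omega) (by omega))
      (horpos p (i + p) (k + p) (by omega) (by omega) (by omega))
      (horpos p (i + p) (j + p) (by omega) (by omega) (by omega))
    exact Set.disjoint_left.1 hd h1 h2
end

section
/- Let n ≥ 1, let σ be a permutation of Fin (2n) that is a single cycle of length 2n, and let ρ be a fixed-point-free involution of Fin (2n) whose orbit partition {{m, ρ m} : m ∈ Fin (2n)} is intersection-free with respect to σ. Then for every m ∈ Fin (2n) there exists an odd integer k with 1 ≤ k < 2n such that ρ(m) = σ^k(m). -/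
theorem stmt9 (n : ℕ) (hn : 1 ≤ n) (σ ρ : Equiv.Perm (Fin (2 * n)))
    (hσ : σ.IsCycle) (hσlen : σ.support.card = 2 * n)
    (hρ2 : ρ * ρ = 1) (hρfix : ∀ m, ρ m ≠ m)
    (hfree : InterFree σ (Set.range fun m => ({m, ρ m} : Set (Fin (2 * n))))) :
    ∀ m : Fin (2 * n), ∃ k : ℕ, Odd k ∧ 1 ≤ k ∧ k < 2 * n ∧ ρ m = (σ ^ k) m := by
  intro m
  have hinv : ∀ x, ρ (ρ x) = x := fun x => by
    have := congrArg (fun f => f x) hρ2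
    simpa using this
  have hsupp : σ.support = Finset.univ := by
    apply Finset.eq_univ_of_card
    simp [hσlen]
  have hmem : ∀ x, σ x ≠ x := fun x => by
    have : x ∈ σ.support := by rw [hsupp]; simp
    simpa using this
  have hord : orderOf σ = 2 * n := by rw [hσ.orderOf, hσlen]
  have hsurj : ∀ x, ∃ i, i < 2 * n ∧ (σ ^ i) m = x := by
    intro x
    obtain ⟨i, hi⟩ := hσ.exists_pow_eq (hmem m) (hmem x)
    refine ⟨i % orderOf σ, (Nat.mod_lt _ (by omega)).trans_eq hord, ?_⟩
    rw [pow_mod_orderOf, hi]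
  have hfinj : Function.Injective (fun i : Fin (2 * n) => (σ ^ (i : ℕ)) m) := by
    apply Finite.injective_iff_surjective.mpr
    intro x
    obtain ⟨i, hi, h⟩ := hsurj x
    exact ⟨⟨i, hi⟩, h⟩
  have hinj : ∀ i j, i < 2 * n → j < 2 * n → (σ ^ i) m = (σ ^ j) m → i = j := by
    intro i j hi hj h
    have := @hfinj ⟨i, hi⟩ ⟨j, hj⟩ h
    simpa using this
  obtain ⟨k, hk, hkm⟩ := hsurj (ρ m)
  have hk0 : 1 ≤ k := by
    rcases Nat.eq_zero_or_pos k with h | h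
    · subst h
      exact absurd (by simpa using hkm.symm) (hρfix m)
    · exact h
  refine ⟨k, ?_, hk0, hk, hkm.symm⟩
  let S : Finset (Fin (2 * n)) := (Finset.Ioo 0 k).image (fun i => (σ ^ i) m)
  have hS : S.card = k - 1 := by
    rw [Finset.card_image_of_injOn]
    · simp
    · intro i hi j hj h
      simp only [Finset.coe_Ioo, Set.mem_Ioo] at hi hj
      exact hinj i j (by omega) (by omega) h
  have hclosed : ∀ x ∈ S, ρ x ∈ S := by
    intro x hx
    simp only [S, Finset.mem_image, Finset.mem_Ioo] at hx ⊢
    obtain ⟨i, ⟨hi0, hik⟩, rfl⟩ := hx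
    obtain ⟨l, hl, hlx⟩ := hsurj (ρ ((σ ^ i) m))
    refine ⟨l, ⟨?_, ?_⟩, hlx⟩
    · by_contra h
      have h0 : l = 0 := by omega
      subst h0
      have h1 : ρ m = (σ ^ i) m := by
        rw [← hinv ((σ ^ i) m), ← hlx]; simp
      have := hinj k i hk (by omega) (hkm.trans h1)
      omega
    · by_contra h
      rcases (not_lt.mp h).eq_or_lt with h | h
      · subst h
        have h1 : m = (σ ^ i) m := ρ.injective (hkm.symm.trans hlx)
        have := hinj 0 i (by omega) (by omega) (by simpa using h1)
        omega
      · exact hfree ⟨m, i, k, l, hi0, hik, h, hl, ⟨m, by simp [hkm]⟩,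
          ⟨(σ ^ i) m, by simp [hlx]⟩⟩
  have hsum : ∑ x ∈ S, (1 : ZMod 2) = 0 :=
    Finset.sum_involution (fun x _ => ρ x) (fun _ _ => by decide)
      (fun x _ _ => hρfix x) hclosed (fun x _ => hinv x)
  rw [Finset.sum_const, nsmul_eq_mul, mul_one, hS, ZMod.natCast_eq_zero_iff] at hsum
  rw [Nat.odd_iff]
  omega
end

section
/- Let n ≥ 1, let σ be a permutation of Fin (2n) that is a single cycle of length 2n, and let ρ₁, ρ₂, ρ₃ be fixed-point-free involutions of Fin (2n) such that for each i ∈ {1,2,3} the orbit partition {{m, ρᵢ m} : m ∈ Fin (2n)} is intersection-free with respect to σ. Then there exists a map c : Fin (2n) → Bool such that c(ρᵢ(x)) ≠ c(x) for all i ∈ {1,2,3} and all x ∈ Fin (2n). -/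
theorem odd_aux (n : ℕ) (σ : Equiv.Perm (Fin (2 * n)))
    (hE : ∀ x y, ∃ j < 2 * n, (σ ^ j) x = y)
    (hI : ∀ x (a b : ℕ), (σ ^ a) x = (σ ^ b) x ↔ a ≡ b [MOD 2 * n])
    (ρ : Equiv.Perm (Fin (2 * n)))
    (h2 : ρ * ρ = 1) (hfix : ∀ m, ρ m ≠ m)
    (hfree : InterFree σ (Set.range fun m => ({m, ρ m} : Set (Fin (2 * n)))))
    (m : Fin (2 * n)) (j : ℕ) (hj : j < 2 * n) (hm : (σ ^ j) m = ρ m) : Odd j := by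
  have hρ : ∀ x, ρ (ρ x) = x := fun x => by
    have := congrArg (fun f : Equiv.Perm (Fin (2 * n)) => f x) h2
    simpa using this
  have hinj : ∀ a b : ℕ, a < 2 * n → b < 2 * n → (σ ^ a) m = (σ ^ b) m → a = b := by
    intro a b ha hb h
    exact Nat.ModEq.eq_of_lt_of_lt ((hI m a b).1 h) ha hb
  have hj0 : j ≠ 0 := by
    rintro rfl
    exact hfix m (by simpa using hm.symm)
  choose g hg1 hg2 using fun i : ℕ => hE m (ρ ((σ ^ i) m))
  have hmem : ∀ i ∈ Finset.Ioo 0 j, g i ∈ Finset.Ioo 0 j := by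
    intro i hi
    rw [Finset.mem_Ioo] at hi ⊢
    have hk := hg1 i
    have hk2 := hg2 i
    refine ⟨?_, ?_⟩
    · rcases Nat.eq_zero_or_pos (g i) with h | h
      · rw [h] at hk2
        have h3 : (σ ^ j) m = (σ ^ i) m := by
          rw [hm, ← hρ ((σ ^ i) m), ← hk2]; simp
        have := hinj _ _ hj (by omega) h3
        omega
      · exact h
    · by_contra hlt
      rcases Nat.eq_or_lt_of_le (not_lt.1 hlt) with h | h
      · rw [← h, hm] at hk2
        have h3 : (σ ^ 0) m = (σ ^ i) m := by simpa using ρ.injective hk2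
        have := hinj _ _ (by omega) (by omega) h3
        omega
      · exact hfree ⟨m, i, j, g i, hi.1, hi.2, h, hk, ⟨m, by simp [hm]⟩,
          ⟨(σ ^ i) m, by simp [hk2]⟩⟩
  have hs : ∑ i ∈ Finset.Ioo 0 j, (1 : ZMod 2) = 0 := by
    refine Finset.sum_involution (fun i _ => g i) ?_ ?_ hmem ?_
    · intro i hi; decide
    · intro i hi _ h
      have := hg2 i
      rw [h] at this
      exact hfix _ this.symm
    · intro i hi
      rw [Finset.mem_Ioo] at hi
      apply hinj _ _ (hg1 _) (by omega)
      rw [hg2, hg2, hρ]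
  rw [Finset.sum_const, nsmul_one, Nat.card_Ioo, ZMod.natCast_eq_zero_iff] at hs
  rw [Nat.odd_iff]
  omega

theorem stmt11 (n : ℕ) (hn : 1 ≤ n) (σ : Equiv.Perm (Fin (2 * n)))
    (hσ : σ.IsCycle) (hσlen : σ.support.card = 2 * n)
    (ρ₁ ρ₂ ρ₃ : Equiv.Perm (Fin (2 * n)))
    (h₁2 : ρ₁ * ρ₁ = 1) (h₁fix : ∀ m, ρ₁ m ≠ m)
    (h₂2 : ρ₂ * ρ₂ = 1) (h₂fix : ∀ m, ρ₂ m ≠ m)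
    (h₃2 : ρ₃ * ρ₃ = 1) (h₃fix : ∀ m, ρ₃ m ≠ m)
    (hfree₁ : InterFree σ (Set.range fun m => ({m, ρ₁ m} : Set (Fin (2 * n)))))
    (hfree₂ : InterFree σ (Set.range fun m => ({m, ρ₂ m} : Set (Fin (2 * n)))))
    (hfree₃ : InterFree σ (Set.range fun m => ({m, ρ₃ m} : Set (Fin (2 * n))))) :
    ∃ c : Fin (2 * n) → Bool,
      ∀ i ∈ ({ρ₁, ρ₂, ρ₃} : Set (Equiv.Perm (Fin (2 * n)))),
        ∀ x, c (i x) ≠ c x := by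
  have hS : σ.support = Finset.univ := by
    rw [← Finset.card_eq_iff_eq_univ, hσlen, Fintype.card_fin]
  have hC : σ.IsCycleOn (Finset.univ : Finset (Fin (2 * n))) := by
    have := hσ.isCycleOn
    convert this using 1
    ext x
    have : x ∈ σ.support := by rw [hS]; simp
    simpa using this
  have hI : ∀ x (a b : ℕ), (σ ^ a) x = (σ ^ b) x ↔ a ≡ b [MOD 2 * n] := by
    intro x a b
    have := hC.pow_apply_eq_pow_apply (Finset.mem_univ x) (m := a) (n := b)
    simpa using this
  have hE : ∀ x y, ∃ j < 2 * n, (σ ^ j) x = y := by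
    intro x y
    have := hC.exists_pow_eq (Finset.mem_univ x) (Finset.mem_univ y)
    simpa using this
  choose d hd1 hd2 using hE ⟨0, by omega⟩
  have key : ∀ ρ : Equiv.Perm (Fin (2 * n)), ρ * ρ = 1 → (∀ m, ρ m ≠ m) →
      InterFree σ (Set.range fun m => ({m, ρ m} : Set (Fin (2 * n)))) →
      ∀ x, decide (Odd (d (ρ x))) ≠ decide (Odd (d x)) := by
    intro ρ h2 hfix hfree x
    obtain ⟨j, hj, hjx⟩ := hE x (ρ x)
    have ho := odd_aux n σ hE hI ρ h2 hfix hfree x j hj hjx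
    have h : (σ ^ (j + d x)) ⟨0, by omega⟩ = (σ ^ (d (ρ x))) ⟨0, by omega⟩ := by
      rw [pow_add, Equiv.Perm.mul_apply, hd2, hd2, hjx]
    have h3 : j + d x ≡ d (ρ x) [MOD 2] := ((hI _ _ _).1 h).of_mul_right n
    unfold Nat.ModEq at h3
    rw [Nat.odd_iff] at ho
    intro h4
    rw [decide_eq_decide, Nat.odd_iff, Nat.odd_iff] at h4
    omega
  refine ⟨fun x => decide (Odd (d x)), ?_⟩
  intro i hi x
  rcases hi with rfl | rfl | rfl
  · exact key _ h₁2 h₁fix hfree₁ x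
  · exact key _ h₂2 h₂fix hfree₂ x
  · exact key _ h₃2 h₃fix hfree₃ x
end
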